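/- arXiv:2411.17570 — 4 statements merged into one kernel-verified Lean document; each statement's English description precedes it below -/
import Mathlib

section
/- Proposition 1 (pointwise version). Let S be a type (the state space), A a finite nonempty type of actions containing a distinguished control action 0, and τ : S → A → ℝ a treatment-effect function with τ s 0 = 0 for all s ∈ S. Fix N, K with K ≤ N and a state vector s : Fin N → S, and set α i = max_{a ∈ A} τ (s i) a. Let π* : Fin N → A be any induced top-K policy for τ at s, i.e. there is a set T ⊆ Fin N of cardinality K with α i ≥ α j for all i ∈ T, j ∉ T, such that τ (s i) (π* i) = α i for i ∈ T and π* i = 0 for i ∉ T. Then for every policy π : Fin N → A that treats at most K patients (i.e. the set {i : π i ≠ 0} has cardinality at most K), ∑_{i} τ (s i) (π* i) ≥ ∑_{i} τ (s i) (π i). -/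
/-- `π` is an induced top-`K` policy for `f` at state vector `s`:
there is a set `T` of cardinality `K` of patients whose maximal achievable
effect `β i = max_a f (s i) a` dominates that of the non-selected patients;
the policy attains the maximal effect on `T` and is the control action `0`
outside `T`. -/
def IsTopKPolicy {S A : Type*} [Fintype A] [Nonempty A] [Zero A] {N : ℕ}
    (f : S → A → ℝ) (s : Fin N → S) (K : ℕ) (π : Fin N → A) : Prop :=
  ∃ T : Finset (Fin N), T.card = K ∧
    (∀ i ∈ T, ∀ j ∉ T,
      Finset.univ.sup' Finset.univ_nonempty (f (s j)) ≤
        Finset.univ.sup' Finset.univ_nonempty (f (s i))) ∧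
    (∀ i ∈ T, f (s i) (π i) = Finset.univ.sup' Finset.univ_nonempty (f (s i))) ∧
    (∀ i ∉ T, π i = 0)

/-- Proposition 1 (pointwise version): an induced top-`K` policy for the true
treatment-effect function `τ` achieves at least the total treatment effect of
any policy respecting the capacity constraint `K`. -/
theorem topK_policy_optimal_pointwise
    {S A : Type*} [Fintype A] [Nonempty A] [Zero A] [DecidableEq A]
    (τ : S → A → ℝ) (hτ0 : ∀ x : S, τ x 0 = 0)
    (N K : ℕ) (hK : K ≤ N) (s : Fin N → S)
    (πstar : Fin N → A) (hstar : IsTopKPolicy τ s K πstar)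
    (π : Fin N → A)
    (hcap : (Finset.univ.filter (fun i => π i ≠ 0)).card ≤ K) :
    ∑ i, τ (s i) (π i) ≤ ∑ i, τ (s i) (πstar i) := by
  obtain ⟨T, hT, hdom, hatt, hzero⟩ := hstar
  set α : Fin N → ℝ := fun i => Finset.univ.sup' Finset.univ_nonempty (τ (s i)) with hα
  have hle : ∀ i a, τ (s i) a ≤ α i := fun i a =>
    Finset.le_sup' (τ (s i)) (Finset.mem_univ a)
  have hnn : ∀ i, 0 ≤ α i := fun i => by
    have h := hle i 0
    rwa [hτ0] at h
  set U : Finset (Fin N) := Finset.univ.filter (fun i => π i ≠ 0) with hU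
  have h1 : ∑ i, τ (s i) (π i) = ∑ i ∈ U, τ (s i) (π i) := by
    symm
    apply Finset.sum_subset (Finset.subset_univ _)
    intro i _ hi
    have h0 : π i = 0 := by simpa [hU] using hi
    rw [h0, hτ0]
  have h2 : ∑ i, τ (s i) (πstar i) = ∑ i ∈ T, α i := by
    rw [← Finset.sum_subset (Finset.subset_univ T)]
    · exact Finset.sum_congr rfl hatt
    · intro i _ hi
      rw [hzero i hi, hτ0]
  have h3 : ∑ i ∈ U, τ (s i) (π i) ≤ ∑ i ∈ U, α i :=
    Finset.sum_le_sum fun i _ => hle i _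
  have hcard : (U \ T).card ≤ (T \ U).card := by
    have e1 := Finset.card_sdiff_add_card_inter U T
    have e2 := Finset.card_sdiff_add_card_inter T U
    rw [Finset.inter_comm T U] at e2
    omega
  have h4 : ∑ i ∈ U \ T, α i ≤ ∑ i ∈ T \ U, α i := by
    rcases (T \ U).eq_empty_or_nonempty with he | hne
    · have he2 : U \ T = ∅ := by
        rw [← Finset.card_eq_zero]
        rw [he, Finset.card_empty] at hcard
        omega
      rw [he, he2]
    · obtain ⟨m, hm, hmin⟩ := Finset.exists_min_image (T \ U) α hne
      have a1 : ∑ i ∈ U \ T, α i ≤ (U \ T).card • α m :=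
        Finset.sum_le_card_nsmul _ _ _ fun j hj =>
          hdom m (Finset.mem_sdiff.mp hm).1 j (Finset.mem_sdiff.mp hj).2
      have a2 : (T \ U).card • α m ≤ ∑ i ∈ T \ U, α i :=
        Finset.card_nsmul_le_sum _ _ _ hmin
      exact a1.trans ((nsmul_le_nsmul_left (hnn m) hcard).trans a2)
  have e1 := Finset.sum_inter_add_sum_sdiff U T α
  have e2 := Finset.sum_inter_add_sum_sdiff T U α
  rw [Finset.inter_comm T U] at e2
  rw [h1, h2]
  linarith
end

section
/- Proposition 1 (expectation/ATT version). Let S be a measurable space (the state space), A a finite nonempty type of actions containing a distinguished control action 0, and τ : S → A → ℝ a treatment-effect function with τ s 0 = 0 for all s. Let μ be a probability measure on the product space S^{Fin N} (the distribution of the state vector of N patients), let K ≤ N with K ≥ 1, and let π*, π : (Fin N → S) → Fin N → A be policy maps such that for μ-almost every state vector s, π*(s) is an induced top-K policy for τ at s and π(s) treats at most K patients, and such that the functions s ↦ ∑_i τ (s i) (π*_i(s)) and s ↦ ∑_i τ (s i) (π_i(s)) are integrable with respect to μ. Then ATT_K(π*) ≥ ATT_K(π), where ATT_K(ρ) = E_μ[(1/K)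 ∑_{i} τ (s i) (ρ_i(s))]. -/
open MeasureTheory

theorem topK_pointwise {S A : Type*} [Fintype A] [Nonempty A] [Zero A] [DecidableEq A]
    (τ : S → A → ℝ) (hτ0 : ∀ x : S, τ x 0 = 0) {N : ℕ} (K : ℕ) (hK1 : 1 ≤ K)
    (s : Fin N → S) (p q : Fin N → A) (hp : IsTopKPolicy τ s K p)
    (hq : (Finset.univ.filter (fun i => q i ≠ 0)).card ≤ K) :
    ∑ i, τ (s i) (q i) ≤ ∑ i, τ (s i) (p i) := by
  obtain ⟨T, hT, h1, h2, h3⟩ := hp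
  set β : Fin N → ℝ := fun i => Finset.univ.sup' Finset.univ_nonempty (τ (s i)) with hβ
  have hle : ∀ i a, τ (s i) a ≤ β i := fun i a => Finset.le_sup' (τ (s i)) (Finset.mem_univ a)
  have hTne : T.Nonempty := Finset.card_pos.mp (by omega)
  obtain ⟨m, hm, hmin⟩ := T.exists_min_image β hTne
  have hc0 : 0 ≤ β m := by
    have := hle m 0
    rwa [hτ0] at this
  set U := Finset.univ.filter (fun i => q i ≠ 0) with hU
  have key : ∀ i, τ (s i) (q i) ≤
      (if i ∈ U then β m else 0) + (if i ∈ T then β i - β m else 0) := by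
    intro i
    have hi := hle i (q i)
    by_cases hiU : i ∈ U <;> by_cases hiT : i ∈ T
    · simp only [hiU, hiT, if_true]; linarith
    · have : β i ≤ β m := h1 m hm i hiT
      simp only [hiU, hiT, if_true, if_false]; linarith
    · have h0 : q i = 0 := by simpa [hU] using hiU
      have := hmin i hiT
      simp only [hiU, hiT, if_true, if_false, h0, hτ0]; linarith
    · have h0 : q i = 0 := by simpa [hU] using hiU
      simp [hiU, hiT, h0, hτ0]
  have hstar : ∑ i, τ (s i) (p i) = ∑ i ∈ T, β i := by
    rw [← Finset.sum_subset (Finset.subset_univ T)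
      (fun i _ hi => by rw [h3 i hi, hτ0])]
    exact Finset.sum_congr rfl h2
  have hsum := Finset.sum_le_sum (fun i (_ : i ∈ Finset.univ) => key i)
  rw [Finset.sum_add_distrib, Finset.sum_ite_mem, Finset.sum_ite_mem, Finset.univ_inter,
    Finset.univ_inter, Finset.sum_sub_distrib, Finset.sum_const, Finset.sum_const, hT,
    nsmul_eq_mul, nsmul_eq_mul] at hsum
  have hUK : (U.card : ℝ) ≤ K := by exact_mod_cast hq
  have := mul_le_mul_of_nonneg_right hUK hc0
  rw [hstar]
  linarith

/-- Proposition 1 (expectation / ATT version): the induced top-`K` policy for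
the true CATE function `τ` maximizes the average treatment effect on the
treated, `ATT_K(ρ) = E_μ[(1/K) ∑ i, τ (s i) (ρ i s)]`, among all policy maps
respecting the capacity constraint `K`. -/
theorem topK_policy_optimal_ATT
    {S : Type*} [MeasurableSpace S]
    {A : Type*} [Fintype A] [Nonempty A] [Zero A] [DecidableEq A]
    (τ : S → A → ℝ) (hτ0 : ∀ x : S, τ x 0 = 0)
    (N K : ℕ) (hK1 : 1 ≤ K) (hKN : K ≤ N)
    (μ : Measure (Fin N → S)) [IsProbabilityMeasure μ]
    (πstar π : (Fin N → S) → Fin N → A)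
    (hstar : ∀ᵐ s ∂μ, IsTopKPolicy τ s K (πstar s))
    (hcap : ∀ᵐ s ∂μ, (Finset.univ.filter (fun i => π s i ≠ 0)).card ≤ K)
    (hint_star : Integrable (fun s => ∑ i, τ (s i) (πstar s i)) μ)
    (hint : Integrable (fun s => ∑ i, τ (s i) (π s i)) μ) :
    ∫ s, (1 / (K : ℝ)) * ∑ i, τ (s i) (π s i) ∂μ ≤
      ∫ s, (1 / (K : ℝ)) * ∑ i, τ (s i) (πstar s i) ∂μ := by
  have hK : (0 : ℝ) ≤ 1 / (K : ℝ) := by positivity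
  refine integral_mono_ae (hint.const_mul _) (hint_star.const_mul _) ?_
  filter_upwards [hstar, hcap] with s hs hc
  exact mul_le_mul_of_nonneg_left (topK_pointwise τ hτ0 K hK1 s _ _ hs hc) hK
end

section
/- Quantitative perturbation bound (deterministic core of Theorem 1). Let S be a type, A a finite nonempty type of actions containing a distinguished control action 0, and τ : S → A → ℝ with τ s 0 = 0 for all s. Fix N ≥ 1, 1 ≤ K ≤ N, a state vector s : Fin N → S, and an estimated function τ̂ : S → A → ℝ with |τ (s i) a − τ̂ (s i) a| ≤ ε for all i ∈ Fin N and a ∈ A, where ε ≥ 0. Let π be an induced top-K policy for τ̂ at s and π* an induced top-K policy for τ at s. Then 0 ≥ (1/K) ∑_{i} ( τ (s i) (π i) − τ (s i) (π* i) ) ≥ −2 (N/K) ε; in particular |(1/K) ∑_{i} ( τ (s i) (π i) − τ (s i) (π* i) )| ≤ 2 (N/K) ε. -/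
theorem topK_sum_le {N : ℕ} (b : Fin N → ℝ) (T U : Finset (Fin N)) (hc : T.card = U.card)
    (h : ∀ i ∈ T, ∀ j ∉ T, b j ≤ b i) : ∑ i ∈ U, b i ≤ ∑ i ∈ T, b i := by
  have hcard : (T \ U).card = (U \ T).card := Finset.card_sdiff_comm hc
  have e1 := Finset.sum_inter_add_sum_sdiff U T b
  have e2 := Finset.sum_inter_add_sum_sdiff T U b
  rw [Finset.inter_comm] at e2
  have key : ∑ i ∈ U \ T, b i ≤ ∑ i ∈ T \ U, b i := by
    rcases (T \ U).eq_empty_or_nonempty with h0 | hne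
    · rw [h0, Finset.card_empty] at hcard
      rw [h0, Finset.card_eq_zero.mp hcard.symm]
    · obtain ⟨i0, hi0, hmin⟩ := Finset.exists_min_image (T \ U) b hne
      calc ∑ i ∈ U \ T, b i ≤ (U \ T).card • b i0 :=
            Finset.sum_le_card_nsmul _ _ _ (fun j hj =>
              h i0 (Finset.mem_sdiff.mp hi0).1 j (Finset.mem_sdiff.mp hj).2)
        _ = (T \ U).card • b i0 := by rw [hcard]
        _ ≤ _ := Finset.card_nsmul_le_sum _ _ _ hmin
  linarith

theorem topK_sum_eq {S A : Type*} [Zero A] {N : ℕ} (τ : S → A → ℝ) (hτ0 : ∀ x : S, τ x 0 = 0)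
    (s : Fin N → S) (π : Fin N → A) (T : Finset (Fin N)) (h : ∀ i ∉ T, π i = 0) :
    ∑ i, τ (s i) (π i) = ∑ i ∈ T, τ (s i) (π i) := by
  symm
  apply Finset.sum_subset (Finset.subset_univ T)
  intro i _ hi
  rw [h i hi, hτ0]

/-- Quantitative perturbation bound (deterministic core of Theorem 1):
if `τ̂` uniformly approximates `τ` to within `ε` on the states `s i`, then the
regret of the top-`K` policy induced by `τ̂` relative to the top-`K` policy
induced by `τ` lies in `[-2 (N/K) ε, 0]`; in particular its absolute value is
at most `2 (N/K) ε`. -/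
theorem topK_policy_perturbation_bound
    {S A : Type*} [Fintype A] [Nonempty A] [Zero A]
    (τ : S → A → ℝ) (hτ0 : ∀ x : S, τ x 0 = 0)
    (N K : ℕ) (hN : 1 ≤ N) (hK1 : 1 ≤ K) (hKN : K ≤ N)
    (s : Fin N → S) (τhat : S → A → ℝ) (ε : ℝ) (hε : 0 ≤ ε)
    (herr : ∀ (i : Fin N) (a : A), |τ (s i) a - τhat (s i) a| ≤ ε)
    (π : Fin N → A) (hπ : IsTopKPolicy τhat s K π)
    (πstar : Fin N → A) (hπstar : IsTopKPolicy τ s K πstar) :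
    ((1 / (K : ℝ)) * ∑ i, (τ (s i) (π i) - τ (s i) (πstar i)) ≤ 0 ∧
      -(2 * ((N : ℝ) / (K : ℝ)) * ε) ≤
        (1 / (K : ℝ)) * ∑ i, (τ (s i) (π i) - τ (s i) (πstar i))) ∧
    |(1 / (K : ℝ)) * ∑ i, (τ (s i) (π i) - τ (s i) (πstar i))| ≤
      2 * ((N : ℝ) / (K : ℝ)) * ε := by
  obtain ⟨T, hTc, hT1, hT2, hT3⟩ := hπ
  obtain ⟨U, hUc, hU1, hU2, hU3⟩ := hπstar
  have hKpos : (0 : ℝ) < K := by exact_mod_cast hK1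
  have hKN' : (K : ℝ) ≤ N := by exact_mod_cast hKN
  have up : ∑ i, (τ (s i) (π i) - τ (s i) (πstar i)) ≤ 0 := by
    rw [Finset.sum_sub_distrib, topK_sum_eq τ hτ0 s π T hT3, topK_sum_eq τ hτ0 s πstar U hU3,
      Finset.sum_congr rfl hU2]
    have h1 := topK_sum_le _ U T (hUc.trans hTc.symm) hU1
    have h2 : ∑ i ∈ T, τ (s i) (π i) ≤
        ∑ i ∈ T, Finset.univ.sup' Finset.univ_nonempty (τ (s i)) :=
      Finset.sum_le_sum fun i _ => Finset.le_sup' (τ (s i)) (Finset.mem_univ (π i))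
    linarith
  have low : -(2 * K * ε) ≤ ∑ i, (τ (s i) (π i) - τ (s i) (πstar i)) := by
    rw [Finset.sum_sub_distrib, topK_sum_eq τ hτ0 s π T hT3, topK_sum_eq τ hτ0 s πstar U hU3]
    have h1 := topK_sum_le _ T U (hTc.trans hUc.symm) hT1
    have h2 : ∑ i ∈ T, (Finset.univ.sup' Finset.univ_nonempty (τhat (s i)) - ε) ≤
        ∑ i ∈ T, τ (s i) (π i) := by
      refine Finset.sum_le_sum fun i hi => ?_
      rw [← hT2 i hi]
      linarith [(abs_le.mp (herr i (π i))).1]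
    have h3 : ∑ i ∈ U, τ (s i) (πstar i) ≤
        ∑ i ∈ U, (Finset.univ.sup' Finset.univ_nonempty (τhat (s i)) + ε) := by
      refine Finset.sum_le_sum fun i _ => ?_
      linarith [(abs_le.mp (herr i (πstar i))).2,
        Finset.le_sup' (τhat (s i)) (Finset.mem_univ (πstar i))]
    rw [Finset.sum_sub_distrib, Finset.sum_const, nsmul_eq_mul, hTc] at h2
    rw [Finset.sum_add_distrib, Finset.sum_const, nsmul_eq_mul, hUc] at h3
    linarith
  generalize ∑ i, (τ (s i) (π i) - τ (s i) (πstar i)) = X at up low ⊢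
  have hinv : 0 ≤ 1 / (K : ℝ) := by positivity
  have a1 : 1 / (K : ℝ) * X ≤ 0 := mul_nonpos_of_nonneg_of_nonpos hinv up
  have a2 : -(2 * ((N : ℝ) / (K : ℝ)) * ε) ≤ 1 / (K : ℝ) * X := by
    have h1 : -(2 * (N : ℝ) * ε) ≤ X := by nlinarith
    calc -(2 * ((N : ℝ) / (K : ℝ)) * ε) = 1 / (K : ℝ) * (-(2 * (N : ℝ) * ε)) := by ring
      _ ≤ _ := mul_le_mul_of_nonneg_left h1 hinv
  refine ⟨⟨a1, a2⟩, abs_le.mpr ⟨a2, a1.trans (by positivity)⟩⟩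
end

section
/- Theorem 1 (convergence-in-probability version). Let (Ω, 𝓕, P) be a probability space, S a type, A a finite nonempty type of actions containing a distinguished control action 0, and τ : S → A → ℝ a function with τ s 0 = 0 for all s and sup_{s ∈ S, a ∈ A} |τ s a| ≤ B for some finite B. Let (K_N) be natural numbers with 1 ≤ K_N ≤ N and K_N / N → c for some c with 0 < c ≤ 1. For each N, let s^N : Ω → (Fin N → S) be a random state vector and τ̂_N : Ω → (S → A → ℝ) a random estimated function such that the random variables ε_N(ω) := sup_{s ∈ S, a ∈ A} |τ s a − τ̂_N(ω) s a| are measurable and converge to 0 in probability (equivalently, in distribution, since the limit is the constant 0). For each N and ω, let π_N(ω) be an induced top-K_N policy for τ̂_N(ω) at s^N(ω) and π*_N(ω) an induced top-K_N policy for τ at s^N(ω), and assume the functions ω ↦ (1/K_N) ∑_{i} τ (s^N(ω) i) (π_N(ω) i) and ω ↦ (1/K_N) ∑_{i} τ (s^N(ω) i) (π*_N(ω) i) are measurable. Then E[(1/K_N) ∑_{i} τ (s^N i) (π_N i)] − E[(1/K_N) ∑_{i} τ (s^N i) (π*_N i)] → 0 as N → ∞; i.e. ATT_{K_N}(π_N)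 − ATT_{K_N}(π*_N) → 0. -/
open Filter MeasureTheory

theorem sum_le_sum_topK {ι : Type*} [DecidableEq ι] (g : ι → ℝ) (T T' : Finset ι)
    (hc : T.card = T'.card) (h : ∀ i ∈ T, ∀ j ∉ T, g j ≤ g i) :
    ∑ i ∈ T', g i ≤ ∑ i ∈ T, g i := by
  have hcard : (T \ T').card = (T' \ T).card := by
    have h1 := Finset.card_sdiff_add_card_inter T T'
    have h2 := Finset.card_sdiff_add_card_inter T' T
    rw [Finset.inter_comm] at h2
    omega
  have key : ∑ i ∈ T' \ T, g i ≤ ∑ i ∈ T \ T', g i := by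
    rcases (T \ T').eq_empty_or_nonempty with he | hne
    · have : T' \ T = ∅ := by
        rw [← Finset.card_eq_zero, ← hcard, he, Finset.card_empty]
      rw [he, this]
    · obtain ⟨m, hm, hmin⟩ := Finset.exists_min_image (T \ T') g hne
      calc ∑ i ∈ T' \ T, g i ≤ (T' \ T).card • g m := by
            apply Finset.sum_le_card_nsmul
            intro j hj
            exact h m (Finset.mem_sdiff.1 hm).1 j (Finset.mem_sdiff.1 hj).2
        _ = (T \ T').card • g m := by rw [hcard]
        _ ≤ _ := Finset.card_nsmul_le_sum _ _ _ hmin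
  have e1 := Finset.sum_inter_add_sum_sdiff T T' g
  have e2 := Finset.sum_inter_add_sum_sdiff T' T g
  rw [Finset.inter_comm] at e2
  linarith

theorem topK_value {S A : Type*} [Zero A] {N : ℕ}
    (τ : S → A → ℝ) (hτ0 : ∀ x : S, τ x 0 = 0) (s : Fin N → S) (π : Fin N → A)
    (T : Finset (Fin N)) (hT : ∀ i ∉ T, π i = 0) :
    ∑ i, τ (s i) (π i) = ∑ i ∈ T, τ (s i) (π i) := by
  symm
  apply Finset.sum_subset (Finset.subset_univ T)
  intro i _ hi
  rw [hT i hi, hτ0]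

theorem topK_bound {S A : Type*} [Fintype A] [Nonempty A] [Zero A] {N : ℕ}
    (τ f : S → A → ℝ) (hτ0 : ∀ x : S, τ x 0 = 0) (B : ℝ)
    (hB : ∀ (x : S) (a : A), |τ x a| ≤ B) (s : Fin N → S) (K : ℕ) (hK : 1 ≤ K)
    (π : Fin N → A) (h : IsTopKPolicy f s K π) :
    |(1 / (K : ℝ)) * ∑ i, τ (s i) (π i)| ≤ B := by
  obtain ⟨T, hc, -, -, h0⟩ := h
  have hK0 : (0 : ℝ) < K := by exact_mod_cast hK
  rw [topK_value τ hτ0 s π T h0, abs_mul, abs_of_pos (by positivity : 0 < 1 / (K : ℝ)),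
    one_div, inv_mul_le_iff₀ hK0]
  calc _ ≤ ∑ i ∈ T, |τ (s i) (π i)| := Finset.abs_sum_le_sum_abs _ _
    _ ≤ T.card • B := Finset.sum_le_card_nsmul _ _ _ (fun i _ => hB _ _)
    _ = K * B := by rw [hc, nsmul_eq_mul]

theorem topK_regret {S A : Type*} [Fintype A] [Nonempty A] [Zero A] {N : ℕ}
    (τ f : S → A → ℝ) (hτ0 : ∀ x : S, τ x 0 = 0) (e : ℝ)
    (he : ∀ (x : S) (a : A), |τ x a - f x a| ≤ e) (s : Fin N → S) (K : ℕ) (hK : 1 ≤ K)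
    (π π' : Fin N → A) (h : IsTopKPolicy f s K π) (h' : IsTopKPolicy τ s K π') :
    |(1 / (K : ℝ)) * ∑ i, τ (s i) (π i) - (1 / (K : ℝ)) * ∑ i, τ (s i) (π' i)| ≤ 2 * e := by
  obtain ⟨T, hc, hle, hmax, h0⟩ := h
  obtain ⟨T', hc', hle', hmax', h0'⟩ := h'
  have hK0 : (0 : ℝ) < K := by exact_mod_cast hK
  rw [topK_value τ hτ0 s π T h0, topK_value τ hτ0 s π' T' h0', ← mul_sub, abs_mul,
    abs_of_pos (by positivity : 0 < 1 / (K : ℝ)), one_div, inv_mul_le_iff₀ hK0]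
  have up : ∑ i ∈ T, τ (s i) (π i) ≤ ∑ i ∈ T', τ (s i) (π' i) := by
    rw [Finset.sum_congr rfl hmax']
    refine le_trans (Finset.sum_le_sum fun i _ => ?_)
      (sum_le_sum_topK (fun i => Finset.univ.sup' Finset.univ_nonempty (τ (s i))) T' T
        (hc'.trans hc.symm) hle')
    exact Finset.le_sup' (τ (s i)) (Finset.mem_univ _)
  have low1 : ∑ i ∈ T, (f (s i) (π i) - e) ≤ ∑ i ∈ T, τ (s i) (π i) :=
    Finset.sum_le_sum fun i _ => by
      have := abs_le.1 (he (s i) (π i)); linarith [this.1]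
  have low2 : ∑ i ∈ T', (τ (s i) (π' i) - e) ≤ ∑ i ∈ T, f (s i) (π i) := by
    rw [Finset.sum_congr rfl hmax]
    refine le_trans (Finset.sum_le_sum fun i _ => ?_)
      (sum_le_sum_topK (fun i => Finset.univ.sup' Finset.univ_nonempty (f (s i))) T T'
        (hc.trans hc'.symm) hle)
    have h1 := abs_le.1 (he (s i) (π' i))
    have h2 := Finset.le_sup' (f (s i)) (Finset.mem_univ (π' i))
    linarith [h1.2]
  rw [Finset.sum_sub_distrib, Finset.sum_const, nsmul_eq_mul, hc] at low1
  rw [Finset.sum_sub_distrib, Finset.sum_const, nsmul_eq_mul, hc'] at low2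
  have := mul_nonneg hK0.le ((abs_nonneg _).trans (he (s ⟨0, by
    have := T.card_le_univ
    rw [Fintype.card_fin] at this
    omega⟩) 0))
  rw [abs_le]
  constructor <;> linarith

/-- Theorem 1 (convergence-in-probability version): if the treatment effects
are uniformly bounded, the uniform estimation error `ε N` converges to zero in
probability, and `K N / N → c ∈ (0, 1]`, then
`ATT_{K N}(π N) - ATT_{K N}(π* N) → 0`, where `π N` are the top-`K N` policies
induced by the random estimates `τ̂ N` and `π* N` are the oracle top-`K N`
policies induced by `τ`. -/
theorem topK_policy_ATT_regret_tendsto_zero_inProb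
    {Ω : Type*} [MeasurableSpace Ω] (P : Measure Ω) [IsProbabilityMeasure P]
    {S A : Type*} [Fintype A] [Nonempty A] [Zero A]
    (τ : S → A → ℝ) (hτ0 : ∀ x : S, τ x 0 = 0)
    (B : ℝ) (hB : ∀ (x : S) (a : A), |τ x a| ≤ B)
    (K : ℕ → ℕ) (hK1 : ∀ N, 1 ≤ N → 1 ≤ K N) (hKN : ∀ N, 1 ≤ N → K N ≤ N)
    (c : ℝ) (hc0 : 0 < c) (hc1 : c ≤ 1)
    (hKlim : Tendsto (fun N => (K N : ℝ) / (N : ℝ)) atTop (nhds c))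
    (s : (N : ℕ) → Ω → Fin N → S)
    (τhat : ℕ → Ω → S → A → ℝ)
    (ε : ℕ → Ω → ℝ)
    (hεsup : ∀ N ω (x : S) (a : A), |τ x a - τhat N ω x a| ≤ ε N ω)
    (hεmeas : ∀ N, Measurable (ε N))
    (hεprob : ∀ δ : ℝ, 0 < δ →
      Tendsto (fun N => P {ω | δ < ε N ω}) atTop (nhds 0))
    (π : (N : ℕ) → Ω → Fin N → A)
    (hπ : ∀ N, 1 ≤ N → ∀ ω, IsTopKPolicy (τhat N ω) (s N ω) (K N) (π N ω))
    (πstar : (N : ℕ) → Ω → Fin N → A)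
    (hπstar : ∀ N, 1 ≤ N → ∀ ω, IsTopKPolicy τ (s N ω) (K N) (πstar N ω))
    (hmeas : ∀ N, Measurable
      (fun ω => (1 / (K N : ℝ)) * ∑ i, τ (s N ω i) (π N ω i)))
    (hmeas_star : ∀ N, Measurable
      (fun ω => (1 / (K N : ℝ)) * ∑ i, τ (s N ω i) (πstar N ω i))) :
    Tendsto
      (fun N =>
        (∫ ω, (1 / (K N : ℝ)) * ∑ i, τ (s N ω i) (π N ω i) ∂P) -
        (∫ ω, (1 / (K N : ℝ)) * ∑ i, τ (s N ω i) (πstar N ω i) ∂P))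
      atTop (nhds 0) := by
  have hint : ∀ N, 1 ≤ N → ∀ (f : Ω → S → A → ℝ) (p : Ω → Fin N → A),
      (∀ ω, IsTopKPolicy (f ω) (s N ω) (K N) (p ω)) →
      Measurable (fun ω => (1 / (K N : ℝ)) * ∑ i, τ (s N ω i) (p ω i)) →
      Integrable (fun ω => (1 / (K N : ℝ)) * ∑ i, τ (s N ω i) (p ω i)) P := by
    intro N hN f p hp hm
    refine Integrable.of_bound hm.aestronglyMeasurable B (Eventually.of_forall fun ω => ?_)
    exact topK_bound τ (f ω) hτ0 B hB (s N ω) (K N) (hK1 N hN) (p ω) (hp ω)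
  have hbd : ∀ δ : ℝ, 0 < δ → ∀ N, 1 ≤ N →
      |(∫ ω, (1 / (K N : ℝ)) * ∑ i, τ (s N ω i) (π N ω i) ∂P) -
        (∫ ω, (1 / (K N : ℝ)) * ∑ i, τ (s N ω i) (πstar N ω i) ∂P)|
      ≤ 2 * δ + P.real {ω | δ < ε N ω} * (2 * B) := by
    intro δ hδ N hN
    have hms : MeasurableSet {ω | δ < ε N ω} := measurableSet_lt measurable_const (hεmeas N)
    have hi2 : Integrable ({ω | δ < ε N ω}.indicator (fun _ => 2 * B)) P :=
      (integrable_const _).indicator hms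
    rw [← integral_sub (hint N hN _ _ (hπ N hN) (hmeas N))
      (hint N hN (fun _ => τ) _ (hπstar N hN) (hmeas_star N)), ← Real.norm_eq_abs]
    calc _ ≤ ∫ ω, (2 * δ + {ω | δ < ε N ω}.indicator (fun _ => 2 * B) ω) ∂P := by
          refine norm_integral_le_of_norm_le ((integrable_const _).add hi2)
            (Eventually.of_forall fun ω => ?_)
          rw [Real.norm_eq_abs]
          by_cases hω : δ < ε N ω
          · rw [Set.indicator_of_mem (by exact hω)]
            have h1 := topK_bound τ _ hτ0 B hB (s N ω) (K N) (hK1 N hN) _ (hπ N hN ω)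
            have h2 := topK_bound τ _ hτ0 B hB (s N ω) (K N) (hK1 N hN) _ (hπstar N hN ω)
            refine (abs_sub _ _).trans ?_
            linarith
          · rw [Set.indicator_of_notMem (by exact hω)]
            have h1 := topK_regret τ _ hτ0 _ (hεsup N ω) (s N ω) (K N) (hK1 N hN) _ _
              (hπ N hN ω) (hπstar N hN ω)
            have := not_lt.1 hω
            linarith
      _ = _ := by
          rw [integral_add (integrable_const _) hi2, integral_indicator_const _ hms]
          simp
  rw [Metric.tendsto_atTop']
  intro r hr
  have hlim : Tendsto (fun N => 2 * (r / 4) + P.real {ω | r / 4 < ε N ω} * (2 * B)) atTop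
      (nhds (2 * (r / 4) + 0 * (2 * B))) := by
    refine tendsto_const_nhds.add (Tendsto.mul_const _ ?_)
    have := (ENNReal.tendsto_toReal ENNReal.zero_ne_top).comp (hεprob (r / 4) (by positivity))
    rw [ENNReal.toReal_zero] at this
    exact this
  obtain ⟨M, hM⟩ := eventually_atTop.1
    (hlim.eventually (gt_mem_nhds (show 2 * (r / 4) + 0 * (2 * B) < r by linarith)))
  refine ⟨M, fun N hN => ?_⟩
  rw [Real.dist_eq, sub_zero]
  exact (hbd (r / 4) (by positivity) N (by omega)).trans_lt (hM N (by omega))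
end
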